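/- On the hexagonal lattice with L ≥ 8: if a cross-free configuration σ ∈ X satisfies H(σ) = 2L+1, then σ ∈ C_{n,o}^{a,b} for some a, b ∈ Ω and some n ∈ {0, …, L−1}, i.e., σ is a canonical configuration with a protuberance of odd cardinality. Moreover, if n = 0 then |𝔭^{a,b}(σ)| = 2L−1, and if n = L−1 then |𝔭^{a,b}(σ)| = 1. -/

import Mathlib

open scoped Classical BigOperators

namespace IsingHex

/-- Sites of the hexagonal lattice of side length `L` with periodic boundary conditions,
identified with the `2L²` triangular faces of the dual triangular lattice `Λ*`:
`(p, false)` is the up-triangle and `(p, true)` the down-triangle in the rhombic cell `p`. -/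
abbrev Site (L : ℕ) : Type := (ZMod L × ZMod L) × Bool

/-- Spin configurations `X = Ω^Λ` with spin set `Ω = Fin q`. -/
abbrev Conf (L q : ℕ) : Type := Site L → Fin q

/-- Adjacency of the hexagonal lattice: the up-triangle `(p, false)` is adjacent to the
down-triangles `(p, true)`, `(p - (1,0), true)` and `(p - (0,1), true)`. -/
def hexAdj {L : ℕ} (v w : Site L) : Prop :=
  (v.2 = false ∧ w.2 = true ∧
     (w.1 = v.1 ∨ w.1 = (v.1.1 - 1, v.1.2) ∨ w.1 = (v.1.1, v.1.2 - 1))) ∨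
  (v.2 = true ∧ w.2 = false ∧
     (v.1 = w.1 ∨ v.1 = (w.1.1 - 1, w.1.2) ∨ v.1 = (w.1.1, w.1.2 - 1)))

/-- The Hamiltonian `H(σ)`: the number of edges of `Λ` whose endpoints carry different
spins; each edge is counted exactly once through its unique up-triangle endpoint. -/
noncomputable def Ham (L q : ℕ) (σ : Conf L q) : ℕ :=
  Nat.card {e : Site L × Site L // e.1.2 = false ∧ hexAdj e.1 e.2 ∧ σ e.1 ≠ σ e.2}

/-- The monochromatic ground state `𝐚`. -/
def groundConf (L q : ℕ) (a : Fin q) : Conf L q := fun _ => a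

/-- The set `S = {𝟏, …, 𝐪}` of ground states. -/
def groundSet (L q : ℕ) : Set (Conf L q) := {σ | ∃ a : Fin q, σ = groundConf L q a}

/-- Partition function `Z_β`. -/
noncomputable def Zfun (L q : ℕ) (β : ℝ) : ℝ :=
  ∑' σ : Conf L q, Real.exp (-β * (Ham L q σ : ℝ))

/-- Gibbs measure of a set of configurations. -/
noncomputable def gibbsP (L q : ℕ) (β : ℝ) (A : Set (Conf L q)) : ℝ :=
  (∑' σ : Conf L q, A.indicator (fun ζ => Real.exp (-β * (Ham L q ζ : ℝ))) σ) / Zfun L q β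

/-- `σ ∼ ζ`: the two configurations differ at exactly one site. -/
def oneFlip {L q : ℕ} (σ ζ : Conf L q) : Prop :=
  ∃ x : Site L, σ x ≠ ζ x ∧ ∀ y : Site L, y ≠ x → σ y = ζ y

/-- Metropolis jump rates `c_β(σ, ζ)`. -/
noncomputable def rate (L q : ℕ) (β : ℝ) (σ ζ : Conf L q) : ℝ :=
  if oneFlip σ ζ then Real.exp (-β * max ((Ham L q ζ : ℝ) - (Ham L q σ : ℝ)) 0) else 0

/-- There is a `t`-path of single spin flips connecting `σ` and `ζ`. -/
def ConnBelow (L q : ℕ) (t : ℕ) (σ ζ : Conf L q) : Prop :=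
  ∃ (N : ℕ) (ω : ℕ → Conf L q), ω 0 = σ ∧ ω N = ζ ∧
    (∀ n < N, oneFlip (ω n) (ω (n + 1))) ∧ ∀ n ≤ N, Ham L q (ω n) ≤ t

/-- Communication height `Φ(σ, ζ)`. -/
noncomputable def commHeight (L q : ℕ) (σ ζ : Conf L q) : ℕ :=
  sInf {t : ℕ | ConnBelow L q t σ ζ}

/-- The strip of index `ℓ` in direction `d` (`0` = horizontal, `1` = vertical,
`2` = diagonal): `2L` consecutive triangles winding around the torus. -/
def stripSet (L : ℕ) (d : Fin 3) (ℓ : ZMod L) : Set (Site L) :=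
  if d = 0 then {v | v.1.2 = ℓ}
  else if d = 1 then {v | v.1.1 = ℓ}
  else {v | (v.2 = false ∧ v.1.1 + v.1.2 = ℓ) ∨ (v.2 = true ∧ v.1.1 + v.1.2 = ℓ - 1)}

/-- Strip energy `ΔH_s(σ)`: number of adjacent pairs inside the strip with different spins. -/
noncomputable def stripEnergy (L q : ℕ) (σ : Conf L q) (d : Fin 3) (ℓ : ZMod L) : ℕ :=
  Nat.card {e : Site L × Site L //
    e.1.2 = false ∧ e.1 ∈ stripSet L d ℓ ∧ e.2 ∈ stripSet L d ℓ ∧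
      hexAdj e.1 e.2 ∧ σ e.1 ≠ σ e.2}

/-- The strip `(d, ℓ)` is an `a`-bridge of `σ`. -/
def IsBridgeWith (L q : ℕ) (σ : Conf L q) (d : Fin 3) (ℓ : ZMod L) (a : Fin q) : Prop :=
  ∀ v ∈ stripSet L d ℓ, σ v = a

/-- The strip `(d, ℓ)` is a bridge of `σ`. -/
def IsBridge (L q : ℕ) (σ : Conf L q) (d : Fin 3) (ℓ : ZMod L) : Prop :=
  ∃ a : Fin q, IsBridgeWith L q σ d ℓ a

/-- Cyclic enumeration of the strip `(d, ℓ)` by `ZMod (2L)`, consecutive triangles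
being adjacent. -/
def stripCycle (L : ℕ) (d : Fin 3) (ℓ : ZMod L) (k : ZMod (2 * L)) : Site L :=
  let t : ZMod L := ((k.val / 2 : ℕ) : ZMod L)
  if d = 0 then ((t, ℓ), decide (k.val % 2 = 1))
  else if d = 1 then ((ℓ, t), decide (k.val % 2 = 1))
  else if k.val % 2 = 1 then ((t, ℓ - 1 - t), true) else ((t, ℓ - t), false)

/-- A set of triangles is an arc (a set of consecutive triangles) of the strip `(d, ℓ)`. -/
def IsArc (L : ℕ) (d : Fin 3) (ℓ : ZMod L) (S : Set (Site L)) : Prop :=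
  ∃ (s : ZMod (2 * L)) (m : ℕ),
    S = (fun k : ℕ => stripCycle L d ℓ (s + (k : ZMod (2 * L)))) '' Set.Iio m

/-- The strip `(d, ℓ)` is an `{a,b}`-semibridge of `σ`: it carries exactly the two
spins `a ≠ b`, and the sites carrying each spin are consecutive in the strip. -/
def IsSemibridgePair (L q : ℕ) (σ : Conf L q) (d : Fin 3) (ℓ : ZMod L) (a b : Fin q) : Prop :=
  a ≠ b ∧ (∀ v ∈ stripSet L d ℓ, σ v = a ∨ σ v = b) ∧
    (∃ v ∈ stripSet L d ℓ, σ v = a) ∧ (∃ v ∈ stripSet L d ℓ, σ v = b) ∧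
    IsArc L d ℓ {v ∈ stripSet L d ℓ | σ v = a} ∧ IsArc L d ℓ {v ∈ stripSet L d ℓ | σ v = b}

/-- The strip `(d, ℓ)` is a semibridge of `σ`. -/
def IsSemibridge (L q : ℕ) (σ : Conf L q) (d : Fin 3) (ℓ : ZMod L) : Prop :=
  ∃ a b : Fin q, IsSemibridgePair L q σ d ℓ a b

/-- `σ` has an `a`-cross: two `a`-bridges in different directions. -/
def HasCross (L q : ℕ) (σ : Conf L q) (a : Fin q) : Prop :=
  ∃ (d d' : Fin 3) (ℓ ℓ' : ZMod L),
    d ≠ d' ∧ IsBridgeWith L q σ d ℓ a ∧ IsBridgeWith L q σ d' ℓ' a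

/-- `σ` is cross-free. -/
def CrossFree (L q : ℕ) (σ : Conf L q) : Prop := ∀ a : Fin q, ¬ HasCross L q σ a

/-- Connected subsets of the torus `𝕋_L` of strip indices (the collection `𝔖_L`). -/
def CircConn (L : ℕ) (P : Set (ZMod L)) : Prop :=
  ∀ x ∈ P, ∀ y ∈ P, ∃ (N : ℕ) (γ : ℕ → ZMod L), γ 0 = x ∧ γ N = y ∧
    (∀ n ≤ N, γ n ∈ P) ∧ ∀ n < N, γ (n + 1) = γ n + 1 ∨ γ (n + 1) = γ n - 1

/-- Union of the strips with indices in `P`, in direction `d`. -/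
def stripUnion (L : ℕ) (d : Fin 3) (P : Set (ZMod L)) : Set (Site L) :=
  ⋃ ℓ ∈ P, stripSet L d ℓ

/-- The configuration `ξ^{a,b}_U`: spin `b` on `U` and spin `a` elsewhere. -/
noncomputable def xiConf (L q : ℕ) (a b : Fin q) (U : Set (Site L)) : Conf L q :=
  fun v => if v ∈ U then b else a

/-- `σ ∈ R_n^{a,b}`: a regular configuration between `𝐚` and `𝐛` built from `n` strips. -/
def IsRegular (L q : ℕ) (σ : Conf L q) (a b : Fin q) (n : ℕ) : Prop :=
  ∃ (d : Fin 3) (P : Set (ZMod L)), CircConn L P ∧ P.ncard = n ∧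
    σ = xiConf L q a b (stripUnion L d P)

/-- The vertices (in the triangular lattice) of the triangle `v`. -/
def triVerts (L : ℕ) (v : Site L) : Set (ZMod L × ZMod L) :=
  if v.2 = false then {v.1, (v.1.1 + 1, v.1.2), (v.1.1, v.1.2 + 1)}
  else {(v.1.1 + 1, v.1.2), (v.1.1, v.1.2 + 1), (v.1.1 + 1, v.1.2 + 1)}

/-- A connected set of triangles (connected through shared sides). -/
def ConnSet (L : ℕ) (U : Set (Site L)) : Prop :=
  ∀ x ∈ U, ∀ y ∈ U, ∃ (N : ℕ) (γ : ℕ → Site L), γ 0 = x ∧ γ N = y ∧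
    (∀ n ≤ N, γ n ∈ U) ∧ ∀ n < N, hexAdj (γ n) (γ (n + 1))

/-- A one-dimensional canonical set inside the strip `(d, ℓ)`. -/
def OneDimCanonical (L : ℕ) (d : Fin 3) (ℓ : ZMod L) (U : Set (Site L)) : Prop :=
  U ⊆ stripSet L d ℓ ∧ U.Nonempty ∧ U ≠ stripSet L d ℓ ∧
  (ConnSet L U ∨
    (Even U.ncard ∧ ∃ (U₁ : Set (Site L)) (y : Site L),
      U = U₁ ∪ {y} ∧ y ∉ U₁ ∧ U₁.Nonempty ∧ ConnSet L U₁ ∧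
      (∀ x ∈ U₁, ¬ hexAdj x y) ∧ ∃ x ∈ U₁, (triVerts L x ∩ triVerts L y).Nonempty))

/-- `P ≺ P'`: connected index sets with `P ⊆ P'` and `|P'| = |P| + 1`. -/
def StepPair (L : ℕ) (P P' : Set (ZMod L)) : Prop :=
  CircConn L P ∧ CircConn L P' ∧ P ⊆ P' ∧ P'.ncard = P.ncard + 1

/-- A protuberance attached to `s(P)` inside the strip `(d, ℓ)`: a one-dimensional
canonical set such that, when `1 ≤ |P| ≤ L-2`, at least half of its triangles share a
side with `s(P)`. -/
def IsProtuberance (L : ℕ) (d : Fin 3) (P : Set (ZMod L)) (ℓ : ZMod L)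
    (U : Set (Site L)) : Prop :=
  OneDimCanonical L d ℓ U ∧
    (1 ≤ P.ncard → P.ncard ≤ L - 2 →
      U.ncard ≤ 2 * {x ∈ U | ∃ y ∈ stripUnion L d P, hexAdj x y}.ncard)

/-- `‖σ‖_a`: the number of sites with spin `a`. -/
noncomputable def spinCount (L q : ℕ) (σ : Conf L q) (a : Fin q) : ℕ :=
  Nat.card {x : Site L // σ x = a}

/-- `N̂(S)`: configurations connected to a ground state by a `(2L+2)`-path. -/
def NHatGround (L q : ℕ) : Set (Conf L q) :=
  {ζ | ∃ a : Fin q, ConnBelow L q (2 * L + 2) (groundConf L q a) ζ}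

/-- A nice pair of configurations (relative to the partition class `A`). -/
def NicePair (L q : ℕ) (A : Finset (Fin q)) (σ ζ : Conf L q) : Prop :=
  σ ∉ NHatGround L q ∧ ζ ∉ NHatGround L q ∧ oneFlip σ ζ ∧
    (∑ a ∈ A, spinCount L q σ a) = L ^ 2 ∧ (∑ a ∈ A, spinCount L q ζ a) = L ^ 2 - 1

/-- `u` is the vector of mean hitting times `σ ↦ E_σ[τ_A]` of the Metropolis dynamics:
it vanishes on `A` and satisfies the first-step (harmonicity) equations off `A`. -/
def IsMeanHittingTime (L q : ℕ) (β : ℝ) (A : Set (Conf L q)) (u : Conf L q → ℝ) : Prop :=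
  (∀ σ ∈ A, u σ = 0) ∧
    ∀ σ ∉ A, (∑' ζ : Conf L q, rate L q β σ ζ) * u σ =
      1 + ∑' ζ : Conf L q, rate L q β σ ζ * u ζ

/-- Gibbs weight `μ_β(σ)`. -/
noncomputable def gibbsWeight (L q : ℕ) (β : ℝ) (σ : Conf L q) : ℝ :=
  Real.exp (-β * (Ham L q σ : ℝ)) / Zfun L q β

/-- The Dirichlet form `D_β(f)`. -/
noncomputable def dirichletForm (L q : ℕ) (β : ℝ) (f : Conf L q → ℝ) : ℝ :=
  (1 / 2) * ∑' p : Conf L q × Conf L q,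
    gibbsWeight L q β p.1 * rate L q β p.1 p.2 * (f p.2 - f p.1) ^ 2

/-- `h` is the equilibrium potential `h^β_{A,B}(σ) = P_σ[τ_A < τ_B]`: it equals `1` on
`A`, `0` on `B`, and is harmonic for the Metropolis dynamics off `A ∪ B`. -/
def IsEqPotential (L q : ℕ) (β : ℝ) (A B : Set (Conf L q)) (h : Conf L q → ℝ) : Prop :=
  (∀ σ ∈ A, h σ = 1) ∧ (∀ σ ∈ B, h σ = 0) ∧
    ∀ σ, σ ∉ A → σ ∉ B → (∑' ζ : Conf L q, rate L q β σ ζ * (h σ - h ζ)) = 0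


/-- Disagreement indicator. -/
noncomputable def ind {α : Type*} (x y : α) : ℕ := if x ≠ y then 1 else 0

lemma ind_comm {α : Type*} (x y : α) : ind x y = ind y x := by
  unfold ind; simp only [ne_comm]

lemma ind_self {α : Type*} (x : α) : ind x x = 0 := by simp [ind]

lemma ind_ne {α : Type*} {x y : α} (h : x ≠ y) : ind x y = 1 := by simp [ind, h]

lemma ind_eq_zero {α : Type*} {x y : α} (h : ind x y = 0) : x = y := by
  by_contra hne; rw [ind_ne hne] at h; omega

/-- Strip chart: position `t`, type `b` in the strip `ℓ` of direction `d`. -/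
def ch (L : ℕ) (d : Fin 3) (ℓ t : ZMod L) (b : Bool) : Site L :=
  if d = 0 then ((t, ℓ), b) else if d = 1 then ((ℓ, t), b)
  else if b = true then ((t, ℓ - 1 - t), true) else ((t, ℓ - t), false)

/-- Direction (sign) in which up-triangles of a strip look across its boundary. -/
def eps (L : ℕ) (d : Fin 3) : ZMod L := if d = 2 then 1 else -1

lemma eps_cases (L : ℕ) (d : Fin 3) : eps L d = 1 ∨ eps L d = -1 := by
  unfold eps; split_ifs <;> simp

lemma eps_mul (L : ℕ) (d : Fin 3) : eps L d * eps L d = 1 := by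
  rcases eps_cases L d with h | h <;> rw [h] <;> ring

lemma ch_snd (L : ℕ) (d : Fin 3) (ℓ t : ZMod L) (b : Bool) : (ch L d ℓ t b).2 = b := by
  fin_cases d <;> cases b <;> simp [ch]

lemma mem_strip (L : ℕ) (d : Fin 3) (ℓ : ZMod L) (v : Site L) :
    v ∈ stripSet L d ℓ ↔ ∃ t b, v = ch L d ℓ t b := by
  obtain ⟨⟨i, j⟩, b⟩ := v
  constructor
  · intro h
    fin_cases d
    · exact ⟨i, b, by simp [stripSet] at h; simp [ch, h]⟩
    · exact ⟨j, b, by simp [stripSet] at h; simp [ch, h]⟩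
    · refine ⟨i, b, ?_⟩
      simp [stripSet] at h
      rcases h with ⟨h1, h2⟩ | ⟨h1, h2⟩
      · subst h1; simp [ch, ← h2]
      · subst h1; simp [ch]; linear_combination h2
  · rintro ⟨t, b', h⟩
    fin_cases d <;> cases b' <;> simp [ch] at h <;> simp [stripSet, h]

lemma ch_inj {L : ℕ} {d : Fin 3} {ℓ t ℓ' t' : ZMod L} {b b' : Bool}
    (h : ch L d ℓ t b = ch L d ℓ' t' b') : ℓ = ℓ' ∧ t = t' ∧ b = b' := by
  have hb : b = b' := by simpa [ch_snd] using congrArg Prod.snd h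
  subst hb
  fin_cases d <;> cases b <;> simp [ch] at h <;> obtain ⟨h1, h2⟩ := h <;> subst h1 <;>
    simp_all

lemma ch_surj {L : ℕ} (d : Fin 3) (v : Site L) : ∃ ℓ t b, v = ch L d ℓ t b := by
  obtain ⟨⟨i, j⟩, b⟩ := v
  fin_cases d
  · exact ⟨j, i, b, by simp [ch]⟩
  · exact ⟨i, j, b, by simp [ch]⟩
  · cases b
    · exact ⟨i + j, i, false, by simp [ch]⟩
    · exact ⟨i + j + 1, i, true, by simp [ch]⟩

lemma hexAdj_symm {L : ℕ} {v w : Site L} (h : hexAdj v w) : hexAdj w v := by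
  rcases h with ⟨a, b, c⟩ | ⟨a, b, c⟩
  · exact Or.inr ⟨b, a, c⟩
  · exact Or.inl ⟨b, a, c⟩

lemma adj1 (L : ℕ) (d : Fin 3) (ℓ t : ZMod L) :
    hexAdj (ch L d ℓ t false) (ch L d ℓ t true) := by
  left
  refine ⟨ch_snd .., ch_snd .., ?_⟩
  fin_cases d
  · left; simp [ch]
  · left; simp [ch]
  · right; right; simp [ch]; ring

lemma adj2 (L : ℕ) (d : Fin 3) (ℓ t : ZMod L) :
    hexAdj (ch L d ℓ (t + 1) false) (ch L d ℓ t true) := by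
  left
  refine ⟨ch_snd .., ch_snd .., ?_⟩
  fin_cases d
  · right; left; simp [ch]
  · right; right; simp [ch]
  · right; left; simp [ch]; ring

lemma adj3 (L : ℕ) (d : Fin 3) (ℓ t : ZMod L) :
    hexAdj (ch L d ℓ t false) (ch L d (ℓ + eps L d) t true) := by
  left
  refine ⟨ch_snd .., ch_snd .., ?_⟩
  fin_cases d
  · right; right; simp [ch, eps]; ring
  · right; left; simp [ch, eps]; ring
  · left; simp [ch, eps]

lemma sum_cast {L : ℕ} [NeZero L] (e x : ZMod L) (he : e * e = 1) (g : ZMod L → ℕ) :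
    ∑ l : ZMod L, g l = ∑ i ∈ Finset.range L, g (x + e * (i : ZMod L)) := by
  symm
  refine Finset.sum_nbij' (fun i => x + e * (i : ZMod L)) (fun l => (e * (l - x)).val) ?_ ?_ ?_ ?_ ?_
  · simp
  · intro l _; simpa using ZMod.val_lt _
  · intro i hi
    have : e * (x + e * (i : ZMod L) - x) = (i : ZMod L) := by linear_combination (i : ZMod L) * he
    simp only [this]
    exact ZMod.val_cast_of_lt (by simpa using hi)
  · intro l _
    simp only [ZMod.natCast_val, ZMod.cast_id', id]
    linear_combination (l - x) * he
  · simp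

lemma pos_inj {L : ℕ} [NeZero L] {e x : ZMod L} (he : e * e = 1) {i j : ℕ} (hi : i < L) (hj : j < L)
    (h : x + e * (i : ZMod L) = x + e * (j : ZMod L)) : i = j := by
  have h2 : (i : ZMod L) = j := by linear_combination e * h - ((i : ZMod L) - j) * he
  have := congrArg ZMod.val h2
  rwa [ZMod.val_cast_of_lt hi, ZMod.val_cast_of_lt hj] at this

lemma pos_surj {L : ℕ} [NeZero L] {e : ZMod L} (x : ZMod L) (he : e * e = 1) (l : ZMod L) :
    ∃ i < L, l = x + e * (i : ZMod L) := by
  refine ⟨(e * (l - x)).val, ZMod.val_lt _, ?_⟩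
  simp only [ZMod.natCast_val, ZMod.cast_id', id]
  linear_combination (x - l) * he

/-- Edge counts of the three types. -/
noncomputable def A (L q : ℕ) [NeZero L] (σ : Conf L q) (c : ZMod L × ZMod L) : ℕ :=
  ∑ i : ZMod L, ∑ j : ZMod L, ind (σ ((i, j), false)) (σ ((i - c.1, j - c.2), true))

/-- Energy inside a strip. -/
noncomputable def E (L q : ℕ) [NeZero L] (σ : Conf L q) (d : Fin 3) (ℓ : ZMod L) : ℕ :=
  ∑ t : ZMod L, (ind (σ (ch L d ℓ t false)) (σ (ch L d ℓ t true)) +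
    ind (σ (ch L d ℓ (t + 1) false)) (σ (ch L d ℓ t true)))

/-- Energy across strip boundaries. -/
noncomputable def Cr (L q : ℕ) [NeZero L] (σ : Conf L q) (d : Fin 3) (ℓ : ZMod L) : ℕ :=
  ∑ t : ZMod L, ind (σ (ch L d ℓ t false)) (σ (ch L d (ℓ + eps L d) t true))

lemma Ham_eq (L q : ℕ) [NeZero L] (hL : 8 ≤ L) (σ : Conf L q) :
    Ham L q σ = A L q σ (0, 0) + A L q σ (1, 0) + A L q σ (0, 1) := by
  have h10 : (1 : ZMod L) ≠ 0 := by
    have : Fact (1 < L) := ⟨by omega⟩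
    exact one_ne_zero
  have hsub : ∀ x : ZMod L, x ≠ x - 1 := by
    intro x h; apply h10; linear_combination h
  unfold Ham
  rw [Nat.card_eq_fintype_card, Fintype.card_subtype, Finset.card_filter, Fintype.sum_prod_type]
  have key : ∀ p p' : ZMod L × ZMod L,
      (if hexAdj (L := L) (p, false) (p', true) ∧ σ (p, false) ≠ σ (p', true) then 1 else 0 : ℕ) =
      (if p' = p then ind (σ (p, false)) (σ (p', true)) else 0) +
      (if p' = (p.1 - 1, p.2) then ind (σ (p, false)) (σ (p', true)) else 0) +
      (if p' = (p.1, p.2 - 1) then ind (σ (p, false)) (σ (p', true)) else 0) := by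
    rintro ⟨i, j⟩ p'
    have e1 : ((i, j) : ZMod L × ZMod L) ≠ (i - 1, j) := by simpa using hsub _
    have e2 : ((i, j) : ZMod L × ZMod L) ≠ (i, j - 1) := by simpa using hsub _
    have e3 : ((i - 1, j) : ZMod L × ZMod L) ≠ (i, j - 1) := by simp [h10]
    by_cases c1 : p' = (i, j)
    · subst c1; simp [hexAdj, ind, hsub]
    by_cases c2 : p' = (i - 1, j)
    · subst c2; simp [hexAdj, ind, h10]
    by_cases c3 : p' = (i, j - 1)
    · subst c3; simp [hexAdj, ind, h10]
    simp [hexAdj, c1, c2, c3]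
  have key2 : ∀ v : Site L, ∑ w : Site L,
      (if v.2 = false ∧ hexAdj v w ∧ σ v ≠ σ w then 1 else 0 : ℕ) =
      if v.2 = false then ind (σ (v.1, false)) (σ (v.1, true)) +
        ind (σ (v.1, false)) (σ ((v.1.1 - 1, v.1.2), true)) +
        ind (σ (v.1, false)) (σ ((v.1.1, v.1.2 - 1), true)) else 0 := by
    rintro ⟨p, b⟩
    cases b
    · rw [Fintype.sum_prod_type]
      have : ∀ p' : ZMod L × ZMod L, ∑ b : Bool,
          (if ((p, false) : Site L).2 = false ∧ hexAdj (L := L) (p, false) (p', b) ∧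
            σ (p, false) ≠ σ (p', b) then 1 else 0 : ℕ) =
          (if p' = p then ind (σ (p, false)) (σ (p', true)) else 0) +
          (if p' = (p.1 - 1, p.2) then ind (σ (p, false)) (σ (p', true)) else 0) +
          (if p' = (p.1, p.2 - 1) then ind (σ (p, false)) (σ (p', true)) else 0) := by
        intro p'
        rw [← key, Fintype.sum_bool]
        simp [hexAdj]
      rw [Finset.sum_congr rfl (fun p' _ => this p')]
      simp [Finset.sum_add_distrib]
    · simp
  simp only [key2]
  rw [Fintype.sum_prod_type]
  simp [Fintype.sum_prod_type, Finset.sum_add_distrib, A]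

lemma sumE (L q : ℕ) [NeZero L] (σ : Conf L q) :
    ∑ ℓ, E L q σ 0 ℓ = A L q σ (0, 0) + A L q σ (1, 0) ∧
    ∑ ℓ, E L q σ 1 ℓ = A L q σ (0, 0) + A L q σ (0, 1) ∧
    ∑ ℓ, E L q σ 2 ℓ = A L q σ (0, 1) + A L q σ (1, 0) := by
  unfold E A
  simp only [Finset.sum_add_distrib]
  refine ⟨?_, ?_, ?_⟩
  · congr 1
    · rw [Finset.sum_comm]; simp [ch]
    · rw [Finset.sum_comm]
      refine Fintype.sum_equiv (Equiv.addRight 1) _ _ ?_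
      intro x; simp [ch]
  · congr 1
    · simp [ch]
    · refine Finset.sum_congr rfl (fun x _ => ?_)
      refine Fintype.sum_equiv (Equiv.addRight 1) _ _ ?_
      intro x; simp [ch]
  · congr 1
    · rw [Finset.sum_comm]
      refine Finset.sum_congr rfl (fun x _ => ?_)
      refine Fintype.sum_equiv (Equiv.subRight x) _ _ ?_
      intro y; simp [ch, sub_right_comm]
    · rw [Finset.sum_comm]
      refine Fintype.sum_equiv (Equiv.addRight 1) _ _ (fun x => ?_)
      refine Fintype.sum_equiv (Equiv.subRight (x + 1)) _ _ ?_
      intro y; simp [ch, sub_sub, add_comm]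

lemma sumCr (L q : ℕ) [NeZero L] (σ : Conf L q) :
    ∑ ℓ, Cr L q σ 0 ℓ = A L q σ (0, 1) ∧
    ∑ ℓ, Cr L q σ 1 ℓ = A L q σ (1, 0) ∧
    ∑ ℓ, Cr L q σ 2 ℓ = A L q σ (0, 0) := by
  unfold Cr A
  refine ⟨?_, ?_, ?_⟩
  · rw [Finset.sum_comm]; simp [ch, eps, sub_eq_add_neg]
  · simp [ch, eps, sub_eq_add_neg]
  · rw [Finset.sum_comm]
    refine Finset.sum_congr rfl (fun x _ => ?_)
    refine Fintype.sum_equiv (Equiv.subRight x) _ _ ?_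
    intro y; simp [ch, eps]

lemma Ham_strip (L q : ℕ) [NeZero L] (hL : 8 ≤ L) (σ : Conf L q) (d : Fin 3) :
    Ham L q σ = ∑ ℓ, E L q σ d ℓ + ∑ ℓ, Cr L q σ d ℓ := by
  rw [Ham_eq L q hL]
  obtain ⟨a, b, c⟩ := sumE L q σ
  obtain ⟨a', b', c'⟩ := sumCr L q σ
  fin_cases d
  · change _ = ∑ ℓ, E L q σ 0 ℓ + ∑ ℓ, Cr L q σ 0 ℓ
    omega
  · change _ = ∑ ℓ, E L q σ 1 ℓ + ∑ ℓ, Cr L q σ 1 ℓ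
    omega
  · change _ = ∑ ℓ, E L q σ 2 ℓ + ∑ ℓ, Cr L q σ 2 ℓ
    omega

/-! ### Cyclic sequences -/

lemma const_of {α : Type*} (f : ℕ → α) (i j : ℕ) (h : ∀ k, i ≤ k → k < j → f k = f (k + 1)) :
    ∀ k, i ≤ k → k ≤ j → f k = f i := by
  intro k hk
  induction k, hk using Nat.le_induction with
  | base => intro _; rfl
  | succ k hk ih => intro hj; rw [← h k hk (by omega)]; exact ih (by omega)

lemma ind_sum_card {α : Type*} (f : ℕ → α) (s : Finset ℕ) :
    ∑ k ∈ s, ind (f k) (f (k + 1)) = (s.filter (fun k => f k ≠ f (k + 1))).card := by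
  rw [Finset.card_filter]; rfl

lemma cyc_const {α : Type*} (f : ℕ → α) (N : ℕ) (hper : ∀ k, f (k + N) = f k)
    (h : ∑ k ∈ Finset.range N, ind (f k) (f (k + 1)) < 2) : ∀ k ≤ N, f k = f 0 := by
  rw [ind_sum_card] at h
  have h' : (Finset.filter (fun k => f k ≠ f (k + 1)) (Finset.range N)).card ≤ 1 := by omega
  rw [Finset.card_le_one] at h'
  have hall : ∀ k < N, f k = f (k + 1) := by
    intro i hi
    by_contra hne
    have h1 := const_of f 0 i (fun k _ hk => by
      by_contra hc
      have := h' k (by simp; exact ⟨by omega, hc⟩) i (by simp; exact ⟨hi, hne⟩)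
      omega) i (by omega) le_rfl
    have h2 := const_of f (i + 1) N (fun k hk hk2 => by
      by_contra hc
      have := h' k (by simp; exact ⟨by omega, hc⟩) i (by simp; exact ⟨hi, hne⟩)
      omega) N (by omega) le_rfl
    have h3 := hper 0
    rw [zero_add] at h3
    exact hne (by rw [h1, ← h2, h3])
  exact fun k hk => const_of f 0 N (fun k _ hk => hall k hk) k (by omega) hk

lemma cyc_two {α : Type*} (f : ℕ → α) (N : ℕ) (hper : ∀ k, f (k + N) = f k)
    (h : ∑ k ∈ Finset.range N, ind (f k) (f (k + 1)) = 2) :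
    ∃ i j, i < j ∧ j < i + N ∧ f i ≠ f j ∧ (∀ k, i ≤ k → k < j → f k = f i) ∧
      (∀ k, j ≤ k → k < i + N → f k = f j) := by
  rw [ind_sum_card, Finset.card_eq_two] at h
  obtain ⟨x, y, hxy, hs⟩ := h
  wlog hlt : x < y generalizing x y
  · exact this y x hxy.symm (by rw [hs, Finset.pair_comm]) (by omega)
  have hmem : ∀ k, (k < N ∧ f k ≠ f (k + 1)) ↔ (k = x ∨ k = y) := by
    intro k
    have := Finset.ext_iff.1 hs k
    simpa using this
  have hx := (hmem x).2 (Or.inl rfl)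
  have hy := (hmem y).2 (Or.inr rfl)
  have hno : ∀ k, k < N → k ≠ x → k ≠ y → f k = f (k + 1) := by
    intro k hk h1 h2
    by_contra hc
    rcases (hmem k).1 ⟨hk, hc⟩ with h | h <;> contradiction
  have c1 := const_of f (x + 1) y (fun k h1 h2 => hno k (by omega) (by omega) (by omega))
  have c2 := const_of f (y + 1) (x + N) (fun k h1 h2 => by
    by_cases hk : k < N
    · exact hno k hk (by omega) (by omega)
    · obtain ⟨m, rfl⟩ : ∃ m, k = m + N := ⟨k - N, by omega⟩
      rw [show m + N + 1 = (m + 1) + N by ring, hper, hper]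
      exact hno m (by omega) (by omega) (by omega))
  refine ⟨x + 1, y + 1, by omega, by omega, ?_, fun k h1 h2 => c1 k h1 (by omega),
    fun k h1 h2 => c2 k h1 (by omega)⟩
  rw [← c1 y (by omega) le_rfl]
  exact hy.2

/-- Cyclic enumeration of a strip by naturals. -/
def cy (L : ℕ) (d : Fin 3) (ℓ : ZMod L) (k : ℕ) : Site L :=
  ch L d ℓ ((k / 2 : ℕ) : ZMod L) (decide (k % 2 = 1))

lemma cy_even (L : ℕ) (d : Fin 3) (ℓ : ZMod L) (k : ℕ) :
    cy L d ℓ (2 * k) = ch L d ℓ (k : ZMod L) false := by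
  simp [cy]

lemma cy_odd (L : ℕ) (d : Fin 3) (ℓ : ZMod L) (k : ℕ) :
    cy L d ℓ (2 * k + 1) = ch L d ℓ (k : ZMod L) true := by
  have h1 : (2 * k + 1) / 2 = k := by omega
  have h2 : (2 * k + 1) % 2 = 1 := by omega
  simp [cy, h1, h2]

lemma cy_adj (L : ℕ) (d : Fin 3) (ℓ : ZMod L) (k : ℕ) :
    hexAdj (cy L d ℓ k) (cy L d ℓ (k + 1)) := by
  obtain ⟨m, h | h⟩ := Nat.even_or_odd' k
  · rw [h, cy_even, cy_odd]; exact adj1 ..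
  · rw [h, show 2 * m + 1 + 1 = 2 * (m + 1) by ring, cy_even, cy_odd]
    push_cast
    exact hexAdj_symm (adj2 ..)

lemma cy_per (L : ℕ) (d : Fin 3) (ℓ : ZMod L) (k : ℕ) :
    cy L d ℓ (k + 2 * L) = cy L d ℓ k := by
  have h1 : (k + 2 * L) / 2 = k / 2 + L := by omega
  have h2 : (k + 2 * L) % 2 = k % 2 := by omega
  simp [cy, h1, h2]

lemma cy_surj (L : ℕ) [NeZero L] (d : Fin 3) (ℓ t : ZMod L) (b : Bool) :
    ∃ k < 2 * L, ch L d ℓ t b = cy L d ℓ k := by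
  have := ZMod.val_lt t
  cases b
  · exact ⟨2 * t.val, by omega, by rw [cy_even]; simp⟩
  · exact ⟨2 * t.val + 1, by omega, by rw [cy_odd]; simp⟩

lemma sum_range_double (F : ℕ → ℕ) (n : ℕ) :
    ∑ k ∈ Finset.range (2 * n), F k = ∑ t ∈ Finset.range n, (F (2 * t) + F (2 * t + 1)) := by
  induction n with
  | zero => simp
  | succ n ih =>
    rw [show 2 * (n + 1) = 2 * n + 1 + 1 by ring, Finset.sum_range_succ, Finset.sum_range_succ,
      ih, Finset.sum_range_succ]
    ring

lemma E_cy (L q : ℕ) [NeZero L] (σ : Conf L q) (d : Fin 3) (ℓ : ZMod L) :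
    E L q σ d ℓ =
      ∑ k ∈ Finset.range (2 * L), ind (σ (cy L d ℓ k)) (σ (cy L d ℓ (k + 1))) := by
  rw [sum_range_double, E, sum_cast 1 0 (by ring)]
  refine Finset.sum_congr rfl (fun t _ => ?_)
  rw [show 2 * t + 1 + 1 = 2 * (t + 1) by ring, cy_even, cy_odd, cy_even]
  push_cast
  simp [ind_comm]

lemma bridge_of_lt (L q : ℕ) [NeZero L] (σ : Conf L q) (d : Fin 3) (ℓ : ZMod L)
    (h : E L q σ d ℓ < 2) : IsBridge L q σ d ℓ := by
  rw [E_cy] at h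
  have := cyc_const (fun k => σ (cy L d ℓ k)) (2 * L) (fun k => by simp only [cy_per]) h
  refine ⟨σ (cy L d ℓ 0), fun v hv => ?_⟩
  obtain ⟨t, b, rfl⟩ := (mem_strip ..).1 hv
  obtain ⟨k, hk, e⟩ := cy_surj L d ℓ t b
  rw [e]; exact this k hk.le

lemma connSet_arc (L : ℕ) (d : Fin 3) (ℓ : ZMod L) (i j : ℕ) :
    ConnSet L {v | ∃ k, i ≤ k ∧ k < j ∧ v = cy L d ℓ k} := by
  rintro x ⟨k, hk1, hk2, rfl⟩ y ⟨m, hm1, hm2, rfl⟩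
  by_cases hkm : k ≤ m
  · refine ⟨m - k, fun n => cy L d ℓ (k + n), rfl, by simp only; congr 1; omega, ?_, ?_⟩
    · intro n hn; exact ⟨k + n, by omega, by omega, rfl⟩
    · intro n hn; exact cy_adj ..
  · refine ⟨k - m, fun n => cy L d ℓ (k - n), rfl, by simp only; congr 1; omega, ?_, ?_⟩
    · intro n hn; exact ⟨k - n, by omega, by omega, rfl⟩
    · intro n hn
      have := cy_adj L d ℓ (k - (n + 1))
      rw [show k - (n + 1) + 1 = k - n by omega] at this
      exact hexAdj_symm this

lemma arcs_of_two (L q : ℕ) [NeZero L] (σ : Conf L q) (d : Fin 3) (ℓ : ZMod L)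
    (h : E L q σ d ℓ = 2) : ∃ p r : Fin q, p ≠ r ∧
      (∀ t b, σ (ch L d ℓ t b) = p ∨ σ (ch L d ℓ t b) = r) ∧
      (∃ t b, σ (ch L d ℓ t b) = p) ∧ (∃ t b, σ (ch L d ℓ t b) = r) ∧
      ConnSet L {v | v ∈ stripSet L d ℓ ∧ σ v = p} ∧
      ConnSet L {v | v ∈ stripSet L d ℓ ∧ σ v = r} := by
  rw [E_cy] at h
  obtain ⟨i, j, hij, hjN, hne, h1, h2⟩ :=
    cyc_two (fun k => σ (cy L d ℓ k)) (2 * L) (fun k => by simp only [cy_per]) h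
  have hin : ∀ k, cy L d ℓ k ∈ stripSet L d ℓ := fun k => (mem_strip ..).2 ⟨_, _, rfl⟩
  have hL : 0 < L := Nat.pos_of_ne_zero (NeZero.ne L)
  have hmul : ∀ k m, cy L d ℓ (k + 2 * L * m) = cy L d ℓ k := by
    intro k m
    induction m with
    | zero => simp
    | succ m ih => rw [show k + 2 * L * (m + 1) = k + 2 * L * m + 2 * L by ring, cy_per, ih]
  have hs : ∀ v ∈ stripSet L d ℓ, ∃ k, i ≤ k ∧ k < i + 2 * L ∧ v = cy L d ℓ k := by
    intro v hv
    obtain ⟨t, b, rfl⟩ := (mem_strip ..).1 hv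
    obtain ⟨k, hk, e⟩ := cy_surj L d ℓ t b
    -- shift `k` into the window starting at `i`
    set N := 2 * L with hN
    have hmod : (k + (N - i % N)) % N < N := Nat.mod_lt _ (by omega)
    refine ⟨i + (k + (N - i % N)) % N, by omega, by omega, ?_⟩
    rw [e, ← hmul (i + (k + (N - i % N)) % N) ((k + (N - i % N)) / N),
      ← hmul k (i / N + 1)]
    congr 1
    have a1 := Nat.mod_add_div (k + (N - i % N)) N
    have a2 := Nat.mod_add_div i N
    have a3 : i % N < N := Nat.mod_lt _ (by omega)
    rw [mul_add, mul_one]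
    omega
  refine ⟨σ (cy L d ℓ i), σ (cy L d ℓ j), hne, ?_, ⟨_, _, rfl⟩, ⟨_, _, rfl⟩, ?_, ?_⟩
  · intro t b
    obtain ⟨k, k1, k2, e⟩ := hs (ch L d ℓ t b) ((mem_strip ..).2 ⟨_, _, rfl⟩)
    rw [e]
    by_cases hk : k < j
    · exact Or.inl (h1 k k1 hk)
    · exact Or.inr (h2 k (by omega) k2)
  · convert connSet_arc L d ℓ i j using 1
    ext v
    constructor
    · rintro ⟨hv, hp⟩
      obtain ⟨k, k1, k2, e⟩ := hs v hv
      refine ⟨k, k1, ?_, e⟩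
      by_contra hk
      have := h2 k (by omega) k2
      rw [← e, hp] at this
      exact hne this
    · rintro ⟨k, k1, k2, rfl⟩
      exact ⟨hin k, h1 k k1 k2⟩
  · convert connSet_arc L d ℓ j (i + 2 * L) using 1
    ext v
    constructor
    · rintro ⟨hv, hp⟩
      obtain ⟨k, k1, k2, e⟩ := hs v hv
      refine ⟨k, ?_, k2, e⟩
      by_contra hk
      have := h1 k k1 (by omega)
      rw [← e, hp] at this
      exact hne this.symm
    · rintro ⟨k, k1, k2, rfl⟩
      exact ⟨hin k, h2 k k1 k2⟩

lemma strip_meet (L : ℕ) (d d' : Fin 3) (h : d ≠ d') (ℓ ℓ' : ZMod L) :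
    ∃ v, v ∈ stripSet L d ℓ ∧ v ∈ stripSet L d' ℓ' := by
  fin_cases d <;> fin_cases d' <;> simp at h
  · exact ⟨((ℓ', ℓ), false), by simp [stripSet], by simp [stripSet]⟩
  · exact ⟨((ℓ' - ℓ, ℓ), false), by simp [stripSet], by simp [stripSet]⟩
  · exact ⟨((ℓ, ℓ'), false), by simp [stripSet], by simp [stripSet]⟩
  · exact ⟨((ℓ, ℓ' - ℓ), false), by simp [stripSet], by simp [stripSet]⟩
  · exact ⟨((ℓ - ℓ', ℓ'), false), by simp [stripSet], by simp [stripSet]⟩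
  · exact ⟨((ℓ', ℓ - ℓ'), false), by simp [stripSet], by simp [stripSet]⟩

lemma no_two_bridges {L q : ℕ} {σ : Conf L q} (hcf : CrossFree L q σ) {d d' : Fin 3} (h : d ≠ d')
    {ℓ ℓ' : ZMod L} (h1 : IsBridge L q σ d ℓ) (h2 : IsBridge L q σ d' ℓ') : False := by
  obtain ⟨a, ha⟩ := h1
  obtain ⟨b, hb⟩ := h2
  obtain ⟨v, hv, hv'⟩ := strip_meet L d d' h ℓ ℓ'
  have : a = b := by rw [← ha v hv, hb v hv']
  subst this
  exact hcf a ⟨d, d', ℓ, ℓ', h, ha, hb⟩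

lemma E_bridge {L q : ℕ} [NeZero L] {σ : Conf L q} {d : Fin 3} {ℓ : ZMod L}
    (h : IsBridge L q σ d ℓ) : E L q σ d ℓ = 0 := by
  obtain ⟨a, ha⟩ := h
  have : ∀ t b, σ (ch L d ℓ t b) = a := fun t b => ha _ ((mem_strip ..).2 ⟨t, b, rfl⟩)
  simp [E, this, ind_self]

lemma path_one {α : Type*} (c : ℕ → α) (M : ℕ)
    (h : ∑ i ∈ Finset.Ico 1 M, ind (c i) (c (i + 1)) = 1) :
    ∃ n, 1 ≤ n ∧ n < M ∧ (∀ i, 1 ≤ i → i ≤ n → c i = c 1) ∧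
      (∀ i, n < i → i ≤ M → c i = c M) ∧ c 1 ≠ c M := by
  rw [ind_sum_card, Finset.card_eq_one] at h
  obtain ⟨n, hn⟩ := h
  have hmem : ∀ k, ((1 ≤ k ∧ k < M) ∧ c k ≠ c (k + 1)) ↔ k = n := by
    intro k
    have := Finset.ext_iff.1 hn k
    simpa using this
  obtain ⟨⟨n1, n2⟩, n3⟩ := (hmem n).2 rfl
  have hno : ∀ k, 1 ≤ k → k < M → k ≠ n → c k = c (k + 1) := by
    intro k h1 h2 h3
    by_contra hc
    exact h3 ((hmem k).1 ⟨⟨h1, h2⟩, hc⟩)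
  have c1 := const_of c 1 n (fun k a b => hno k a (by omega) (by omega))
  have c2 := const_of c (n + 1) M (fun k a b => hno k (by omega) b (by omega))
  have c3 := c2 M (by omega) le_rfl
  refine ⟨n, n1, n2, c1, fun i a b => by rw [c2 i a b, c3], ?_⟩
  rw [c3, ← c1 n n1 le_rfl]
  exact n3

/-- An interval of strip indices seen from `x` in direction `e`. -/
def iv (L : ℕ) (x e : ZMod L) (a b : ℕ) : Set (ZMod L) :=
  {l | ∃ i : ℕ, a ≤ i ∧ i ≤ b ∧ l = x + e * (i : ZMod L)}

lemma iv_conn (L : ℕ) (x e : ZMod L) (he : e = 1 ∨ e = -1) (a b : ℕ) :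
    CircConn L (iv L x e a b) := by
  rintro _ ⟨k, hk1, hk2, rfl⟩ _ ⟨m, hm1, hm2, rfl⟩
  by_cases hkm : k ≤ m
  · refine ⟨m - k, fun n => x + e * ((k + n : ℕ) : ZMod L), by simp, ?_, ?_, ?_⟩
    · simp only [show k + (m - k) = m by omega]
    · intro n hn; exact ⟨k + n, by omega, by omega, rfl⟩
    · intro n hn
      rcases he with rfl | rfl
      · left; push_cast; ring
      · right; push_cast; ring
  · refine ⟨k - m, fun n => x + e * ((k - n : ℕ) : ZMod L), by simp, ?_, ?_, ?_⟩
    · simp only [show k - (k - m) = m by omega]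
    · intro n hn; exact ⟨k - n, by omega, by omega, rfl⟩
    · intro n hn
      have : ((k - n : ℕ) : ZMod L) = ((k - (n + 1) : ℕ) : ZMod L) + 1 := by
        rw [show k - n = k - (n + 1) + 1 by omega]; push_cast; rfl
      rcases he with rfl | rfl
      · right; simp only [this]; ring
      · left; simp only [this]; ring

lemma iv_ncard (L : ℕ) [NeZero L] (x e : ZMod L) (he : e * e = 1) (a b : ℕ) (hb : b < L) :
    (iv L x e a b).ncard = b + 1 - a := by
  have : iv L x e a b = (fun i : ℕ => x + e * (i : ZMod L)) '' (Finset.Icc a b : Finset ℕ) := by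
    ext l
    simp only [iv, Set.mem_setOf_eq, Set.mem_image, Finset.coe_Icc, Set.mem_Icc]
    constructor
    · rintro ⟨i, h1, h2, rfl⟩; exact ⟨i, ⟨h1, h2⟩, rfl⟩
    · rintro ⟨i, ⟨h1, h2⟩, rfl⟩; exact ⟨i, h1, h2, rfl⟩
  rw [this, Set.ncard_image_of_injOn, Set.ncard_coe_finset, Nat.card_Icc]
  intro i hi j hj h
  simp at hi hj
  exact pos_inj he (by omega) (by omega) h

/-- Number of triangles of type `b` and spin `p` in a strip. -/
noncomputable def cnt (L q : ℕ) [NeZero L] (σ : Conf L q) (d : Fin 3) (ℓ : ZMod L) (p : Fin q)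
    (b : Bool) : ℕ := (Finset.univ.filter (fun t : ZMod L => σ (ch L d ℓ t b) = p)).card

lemma cnt_ncard (L q : ℕ) [NeZero L] (σ : Conf L q) (d : Fin 3) (ℓ : ZMod L) (p : Fin q)
    (b : Bool) : {v | ∃ t, v = ch L d ℓ t b ∧ σ v = p}.ncard = cnt L q σ d ℓ p b := by
  have : {v | ∃ t, v = ch L d ℓ t b ∧ σ v = p} = (fun t => ch L d ℓ t b) ''
      (Finset.univ.filter (fun t : ZMod L => σ (ch L d ℓ t b) = p) : Finset (ZMod L)) := by
    ext v
    simp only [Set.mem_setOf_eq, Set.mem_image, Finset.coe_filter, Finset.mem_univ, true_and]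
    constructor
    · rintro ⟨t, rfl, h⟩; exact ⟨t, h, rfl⟩
    · rintro ⟨t, h, rfl⟩; exact ⟨t, rfl, h⟩
  rw [this, Set.ncard_image_of_injOn, Set.ncard_coe_finset, cnt]
  intro i hi j hj h
  exact (ch_inj h).2.1

lemma strip_ncard (L q : ℕ) [NeZero L] (σ : Conf L q) (d : Fin 3) (ℓ : ZMod L) (p : Fin q) :
    {v | v ∈ stripSet L d ℓ ∧ σ v = p}.ncard = cnt L q σ d ℓ p false + cnt L q σ d ℓ p true := by
  rw [← cnt_ncard, ← cnt_ncard, ← Set.ncard_union_eq]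
  · congr 1
    ext v
    simp only [mem_strip, Set.mem_union, Set.mem_setOf_eq]
    constructor
    · rintro ⟨⟨t, b, rfl⟩, h⟩
      cases b
      · exact Or.inl ⟨t, rfl, h⟩
      · exact Or.inr ⟨t, rfl, h⟩
    · rintro (⟨t, rfl, h⟩ | ⟨t, rfl, h⟩)
      · exact ⟨⟨t, _, rfl⟩, h⟩
      · exact ⟨⟨t, _, rfl⟩, h⟩
  · rw [Set.disjoint_left]
    rintro v ⟨t, rfl, _⟩ ⟨t', h, _⟩
    have := (ch_inj h).2.2
    simp at this

lemma sum_ind_cnt (L q : ℕ) [NeZero L] (σ : Conf L q) (d : Fin 3) (ℓ : ZMod L) (p : Fin q)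
    (b : Bool) : ∑ t, ind (σ (ch L d ℓ t b)) p + cnt L q σ d ℓ p b = L := by
  rw [cnt, Finset.card_filter, ← Finset.sum_add_distrib]
  have : ∀ t, ind (σ (ch L d ℓ t b)) p + (if σ (ch L d ℓ t b) = p then 1 else 0) = 1 := by
    intro t; unfold ind; split_ifs <;> simp_all
  simp [this, ZMod.card]

/-- The target of the main theorem. -/
def Goal (L q : ℕ) (σ : Conf L q) : Prop :=
    ∃ (a b : Fin q) (n : ℕ) (d : Fin 3) (P P' : Set (ZMod L)) (ℓ : ZMod L)
      (U : Set (Site L)),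
      a ≠ b ∧ n ≤ L - 1 ∧ StepPair L P P' ∧ P.ncard = n ∧ P' \ P = {ℓ} ∧
      IsProtuberance L d P ℓ U ∧ Odd U.ncard ∧
      σ = xiConf L q a b (stripUnion L d P ∪ U) ∧
      (n = 0 → U.ncard = 2 * L - 1) ∧ (n = L - 1 → U.ncard = 1)

lemma goal_of (L q : ℕ) [NeZero L] (hL : 8 ≤ L) (σ : Conf L q) (d : Fin 3) (x : ZMod L)
    (p r : Fin q) (hpr : p ≠ r) (hall : ∀ t b, σ (ch L d x t b) = p ∨ σ (ch L d x t b) = r)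
    (hp : ∃ t b, σ (ch L d x t b) = p) (hr : ∃ t b, σ (ch L d x t b) = r)
    (hconn : ConnSet L {v | v ∈ stripSet L d x ∧ σ v = p})
    (n : ℕ) (hn1 : 1 ≤ n) (hn : n ≤ L - 1)
    (h1 : ∀ i : ℕ, 1 ≤ i → i ≤ n → ∀ t b, σ (ch L d (x + eps L d * i) t b) = p)
    (h2 : ∀ i : ℕ, n < i → i < L → ∀ t b, σ (ch L d (x + eps L d * i) t b) = r)
    (hcA : n = L - 1 → cnt L q σ d x p false + cnt L q σ d x p true = 1)
    (hcB : n < L - 1 → cnt L q σ d x p false = cnt L q σ d x p true + 1) : Goal L q σ := by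
  have he := eps_mul L d
  have hx : ∀ i : ℕ, i < L → x = x + eps L d * (i : ZMod L) → i = 0 := by
    intro i hi h
    exact pos_inj (x := x) he hi (by omega) (by rw [← h]; simp)
  have hxP : x ∉ iv L x (eps L d) 1 n := by
    rintro ⟨i, a, b, h⟩
    have := hx i (by omega) h
    omega
  refine ⟨r, p, n, d, iv L x (eps L d) 1 n, iv L x (eps L d) 0 n, x,
    {v | v ∈ stripSet L d x ∧ σ v = p}, hpr.symm, hn, ?_, ?_, ?_, ?_, ?_, ?_, by omega, ?_⟩
  · refine ⟨iv_conn L x _ (eps_cases L d) _ _, iv_conn L x _ (eps_cases L d) _ _, ?_, ?_⟩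
    · rintro _ ⟨i, a, b, rfl⟩; exact ⟨i, by omega, b, rfl⟩
    · rw [iv_ncard L x _ he _ _ (by omega), iv_ncard L x _ he _ _ (by omega)]; omega
  · rw [iv_ncard L x _ he _ _ (by omega)]; omega
  · ext l
    simp only [Set.mem_diff, Set.mem_singleton_iff]
    constructor
    · rintro ⟨⟨i, a, b, rfl⟩, hl⟩
      by_cases hi : i = 0
      · subst hi; simp
      · exact absurd ⟨i, by omega, b, rfl⟩ hl
    · rintro rfl
      exact ⟨⟨0, le_rfl, by omega, by simp⟩, hxP⟩
  · refine ⟨⟨fun v hv => hv.1, ?_, ?_, Or.inl hconn⟩, ?_⟩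
    · obtain ⟨t, b, h⟩ := hp
      exact ⟨_, (mem_strip ..).2 ⟨t, b, rfl⟩, h⟩
    · intro heq
      obtain ⟨t, b, h⟩ := hr
      have : ch L d x t b ∈ stripSet L d x := (mem_strip ..).2 ⟨t, b, rfl⟩
      rw [← heq] at this
      exact hpr (this.2.symm.trans h)
    · intro _ hle
      rw [iv_ncard L x _ he _ _ (by omega)] at hle
      have hB := hcB (by omega)
      rw [strip_ncard]
      have hsub : {v | ∃ t, v = ch L d x t false ∧ σ v = p} ⊆
          {v | v ∈ {v | v ∈ stripSet L d x ∧ σ v = p} ∧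
            ∃ y ∈ stripUnion L d (iv L x (eps L d) 1 n), hexAdj v y} := by
        rintro v ⟨t, rfl, hv⟩
        refine ⟨⟨(mem_strip ..).2 ⟨_, _, rfl⟩, hv⟩, _, ?_, adj3 L d x t⟩
        simp only [stripUnion, Set.mem_iUnion]
        exact ⟨_, ⟨1, le_rfl, hn1, by simp⟩, (mem_strip ..).2 ⟨_, _, rfl⟩⟩
      have := Set.ncard_le_ncard hsub (Set.toFinite _)
      rw [cnt_ncard] at this
      omega
  · rw [strip_ncard]
    by_cases h : n = L - 1
    · rw [hcA h]; exact odd_one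
    · rw [hcB (by omega)]; exact ⟨_, by ring⟩
  · funext v
    obtain ⟨l, t, b, rfl⟩ := ch_surj d v
    obtain ⟨i, hi, rfl⟩ := pos_surj x he l
    unfold xiConf
    by_cases hi0 : i = 0
    · subst hi0
      simp only [Nat.cast_zero, mul_zero, add_zero]
      split_ifs with hm
      · rcases hm with hm | hm
        · simp only [stripUnion, Set.mem_iUnion] at hm
          obtain ⟨l, hl, hm⟩ := hm
          obtain ⟨t', b', e⟩ := (mem_strip ..).1 hm
          rw [← (ch_inj e).1] at hl
          exact absurd hl hxP
        · exact hm.2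
      · rcases hall t b with h | h
        · exact absurd (Or.inr ⟨(mem_strip ..).2 ⟨_, _, rfl⟩, h⟩) hm
        · exact h
    by_cases hin : i ≤ n
    · rw [h1 i (by omega) hin, if_pos]
      left
      simp only [stripUnion, Set.mem_iUnion]
      exact ⟨_, ⟨i, by omega, hin, rfl⟩, (mem_strip ..).2 ⟨_, _, rfl⟩⟩
    · rw [h2 i (by omega) hi, if_neg]
      rintro (hm | hm)
      · simp only [stripUnion, Set.mem_iUnion] at hm
        obtain ⟨l, ⟨j, hj1, hj2, rfl⟩, hm⟩ := hm
        obtain ⟨t', b', e⟩ := (mem_strip ..).1 hm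
        have := pos_inj he hi (by omega) (ch_inj e).1
        omega
      · obtain ⟨t', b', e⟩ := (mem_strip ..).1 hm.1
        exact hi0 (hx i hi (ch_inj e).1.symm)
  · intro h
    rw [strip_ncard]; exact hcA h

lemma main_dir (L q : ℕ) [NeZero L] (hL : 8 ≤ L) (σ : Conf L q) (d : Fin 3) (x : ZMod L)
    (hE : E L q σ d x = 2) (hb : ∀ ℓ, ℓ ≠ x → IsBridge L q σ d ℓ)
    (hC : ∑ ℓ, Cr L q σ d ℓ = 2 * L - 1) : Goal L q σ := by
  have he := eps_mul L d
  have hbr : ∀ i : ℕ, ∃ a : Fin q, 1 ≤ i → i < L →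
      ∀ t b, σ (ch L d (x + eps L d * i) t b) = a := by
    intro i
    by_cases hi : 1 ≤ i ∧ i < L
    · obtain ⟨a, ha⟩ := hb (x + eps L d * i) (by
        intro h
        have := pos_inj (x := x) he hi.2 (show 0 < L by omega) (by rw [h]; simp)
        omega)
      exact ⟨a, fun _ _ t b => ha _ ((mem_strip ..).2 ⟨_, _, rfl⟩)⟩
    · exact ⟨σ (ch L d x 0 false), fun a b => absurd ⟨a, b⟩ hi⟩
  choose c hc using hbr
  obtain ⟨p, r, hpr, hall, hp, hr, hcp, hcr⟩ := arcs_of_two L q σ d x hE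
  -- the cross-boundary energy
  rw [sum_cast (eps L d) x he, Finset.range_eq_Ico, Finset.sum_eq_sum_Ico_succ_bot (by omega)] at hC
  obtain ⟨M, hM⟩ : ∃ M, L = M + 1 := ⟨L - 1, by omega⟩
  have hIco : ∑ i ∈ Finset.Ico (0 + 1) L, Cr L q σ d (x + eps L d * (i : ZMod L)) =
      L * ∑ i ∈ Finset.Ico 1 M, ind (c i) (c (i + 1)) +
      Cr L q σ d (x + eps L d * (M : ZMod L)) := by
    have : Finset.Ico (0 + 1) L = Finset.Ico 1 (M + 1) := by rw [hM]
    rw [this, Finset.sum_Ico_succ_top (by omega), Finset.mul_sum]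
    congr 1
    refine Finset.sum_congr rfl (fun i hi => ?_)
    rw [Finset.mem_Ico] at hi
    unfold Cr
    have e1 : x + eps L d * (i : ZMod L) + eps L d = x + eps L d * ((i + 1 : ℕ) : ZMod L) := by
      push_cast; ring
    have : ∀ t, ind (σ (ch L d (x + eps L d * (i : ZMod L)) t false))
        (σ (ch L d (x + eps L d * (i : ZMod L) + eps L d) t true)) = ind (c i) (c (i + 1)) := by
      intro t
      rw [e1, hc i hi.1 (by omega), hc (i + 1) (by omega) (by omega)]
    rw [Finset.sum_congr rfl (fun t _ => this t)]
    simp [ZMod.card]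
  have hM1 : ((M : ℕ) : ZMod L) + 1 = 0 := by
    have : ((M + 1 : ℕ) : ZMod L) = 0 := by rw [← hM]; simp
    simpa using this
  have hlast : Cr L q σ d (x + eps L d * (M : ZMod L)) = ∑ t, ind (σ (ch L d x t true)) (c M) := by
    unfold Cr
    have e1 : x + eps L d * (M : ZMod L) + eps L d = x := by
      linear_combination (eps L d) * hM1
    refine Finset.sum_congr rfl (fun t _ => ?_)
    rw [e1, hc M (by omega) (by omega), ind_comm]
  have hfirst : Cr L q σ d (x + eps L d * ((0 : ℕ) : ZMod L)) =
      ∑ t, ind (σ (ch L d x t false)) (c 1) := by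
    unfold Cr
    refine Finset.sum_congr rfl (fun t _ => ?_)
    have := hc 1 (by omega) (by omega) t true
    simp only [Nat.cast_one, mul_one] at this
    simp only [Nat.cast_zero, mul_zero, add_zero]
    rw [this]
  rw [hIco, hlast, hfirst] at hC
  set K := ∑ i ∈ Finset.Ico 1 M, ind (c i) (c (i + 1)) with hK
  have hK2 : K < 2 := by
    by_contra h
    have : L * 2 ≤ L * K := Nat.mul_le_mul_left L (by omega)
    omega
  have hfull : ∀ a b, a ≠ p → a ≠ r → ∑ t, ind (σ (ch L d x t b)) a = L := by
    intro a b h1 h2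
    have : ∀ t, ind (σ (ch L d x t b)) a = 1 := by
      intro t
      apply ind_ne
      rcases hall t b with h | h <;> rw [h]
      · exact h1.symm
      · exact h2.symm
    simp [this, ZMod.card]
  have hKconst : K = 0 → ∀ i, 1 ≤ i → i ≤ M → c i = c 1 := by
    intro h0
    rw [hK, Finset.sum_eq_zero_iff] at h0
    exact const_of c 1 M (fun k a b => ind_eq_zero (h0 k (by simp; omega)))
  have hc1 : c 1 = p ∨ c 1 = r := by
    by_contra h
    push Not at h
    rw [hfull (c 1) false h.1 h.2] at hC
    have hK0 : K = 0 := by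
      by_contra hk
      have : L * 1 ≤ L * K := Nat.mul_le_mul_left L (by omega)
      omega
    rw [hKconst hK0 M (by omega) le_rfl, hfull (c 1) true h.1 h.2] at hC
    omega
  -- without loss of generality `c 1 = p`
  wlog hcp1 : c 1 = p generalizing p r
  · exact this r p hpr.symm (fun t b => (hall t b).symm) hr hp hcr hcp
      (fun a b h1 h2 => hfull a b h2 h1) hc1.symm (by tauto)
  have u1 := sum_ind_cnt L q σ d x p false
  have v1 := sum_ind_cnt L q σ d x p true
  rw [hcp1] at hC
  rcases (show K = 0 ∨ K = 1 by omega) with hk | hk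
  · have hco := hKconst hk
    rw [hk, hco M (by omega) le_rfl, hcp1] at hC
    refine goal_of L q hL σ d x p r hpr hall hp hr hcp M (by omega) (by omega) ?_ ?_ ?_ ?_
    · intro i h1 h2 t b
      rw [hc i h1 (by omega), hco i h1 h2, hcp1]
    · intro i h1 h2; omega
    · intro _; omega
    · intro _; omega
  · obtain ⟨n, n1, n2, n3, n4, n5⟩ := path_one c M hk
    rw [hk] at hC
    have hcM : c M = r := by
      by_contra h
      rw [hfull (c M) true (by rw [← hcp1]; exact n5.symm) h] at hC
      omega
    rw [hcM] at hC
    have hv : ∑ t, ind (σ (ch L d x t true)) r = cnt L q σ d x p true := by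
      rw [cnt, Finset.card_filter]
      refine Finset.sum_congr rfl (fun t _ => ?_)
      rcases hall t true with h | h
      · rw [h, ind_ne hpr, if_pos rfl]
      · rw [h, ind_self, if_neg hpr.symm]
    rw [hv] at hC
    refine goal_of L q hL σ d x p r hpr hall hp hr hcp n n1 (by omega) ?_ ?_ ?_ ?_
    · intro i h1 h2 t b
      rw [hc i h1 (by omega), n3 i h1 h2, hcp1]
    · intro i h1 h2 t b
      rw [hc i (by omega) h2, n4 i h1 (by omega), hcM]
    · intro _; omega
    · intro _; omega

lemma no_bridge_sum (L q : ℕ) [NeZero L] (σ : Conf L q) (d : Fin 3)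
    (h : ∀ ℓ, ¬ IsBridge L q σ d ℓ) : 2 * L ≤ ∑ ℓ, E L q σ d ℓ := by
  have : ∑ _ℓ : ZMod L, 2 ≤ ∑ ℓ, E L q σ d ℓ := by
    refine Finset.sum_le_sum (fun ℓ _ => ?_)
    by_contra hc
    exact h ℓ (bridge_of_lt L q σ d ℓ (by omega))
  simp [ZMod.card] at this
  omega

lemma goal_all (L q : ℕ) (hL : 8 ≤ L)
    (σ : Conf L q) (hcf : CrossFree L q σ) (hH : Ham L q σ = 2 * L + 1) : Goal L q σ := by
  have : NeZero L := ⟨by omega⟩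
  obtain ⟨s0, s1, s2⟩ := sumE L q σ
  have hHe := Ham_eq L q hL σ
  have hex : ∃ d, (∃ ℓ, IsBridge L q σ d ℓ) ∧ ∑ ℓ, E L q σ d ℓ ≤ 2 := by
    have step : ∀ d d', (∃ ℓ, IsBridge L q σ d ℓ) → d ≠ d' → 2 * L ≤ ∑ ℓ, E L q σ d' ℓ := by
      rintro d d' ⟨ℓ, h⟩ hne
      exact no_bridge_sum L q σ d' (fun ℓ' h' => no_two_bridges hcf hne h h')
    by_cases h0 : ∃ ℓ, IsBridge L q σ 0 ℓ
    · have := step 0 1 h0 (by decide)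
      have := step 0 2 h0 (by decide)
      exact ⟨0, h0, by omega⟩
    by_cases h1 : ∃ ℓ, IsBridge L q σ 1 ℓ
    · have := step 1 0 h1 (by decide)
      have := step 1 2 h1 (by decide)
      exact ⟨1, h1, by omega⟩
    by_cases h2 : ∃ ℓ, IsBridge L q σ 2 ℓ
    · have := step 2 0 h2 (by decide)
      have := step 2 1 h2 (by decide)
      exact ⟨2, h2, by omega⟩
    push Not at h0 h1 h2
    have := no_bridge_sum L q σ 0 h0
    have := no_bridge_sum L q σ 1 h1
    have := no_bridge_sum L q σ 2 h2
    omega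
  obtain ⟨d, -, hd⟩ := hex
  have hst := Ham_strip L q hL σ d
  by_cases hall : ∀ ℓ, IsBridge L q σ d ℓ
  · exfalso
    have hE0 : ∑ ℓ, E L q σ d ℓ = 0 := Finset.sum_eq_zero (fun ℓ _ => E_bridge (hall ℓ))
    choose c hc using hall
    have hdvd : L ∣ ∑ ℓ, Cr L q σ d ℓ := by
      refine Finset.dvd_sum (fun ℓ _ => ?_)
      have : ∀ t, ind (σ (ch L d ℓ t false)) (σ (ch L d (ℓ + eps L d) t true)) =
          ind (c ℓ) (c (ℓ + eps L d)) := by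
        intro t
        rw [hc ℓ _ ((mem_strip ..).2 ⟨_, _, rfl⟩), hc (ℓ + eps L d) _ ((mem_strip ..).2 ⟨_, _, rfl⟩)]
      unfold Cr
      rw [Finset.sum_congr rfl (fun t _ => this t)]
      simp [ZMod.card]
    rw [show ∑ ℓ, Cr L q σ d ℓ = L * 2 + 1 by omega] at hdvd
    have := (Nat.dvd_add_right (Dvd.intro 2 rfl)).1 hdvd
    have := Nat.le_of_dvd (by omega) this
    omega
  · push Not at hall
    obtain ⟨x, hx⟩ := hall
    have hx2 : 2 ≤ E L q σ d x := by
      by_contra h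
      exact hx (bridge_of_lt L q σ d x (by omega))
    have hsplit := Finset.add_sum_erase Finset.univ (fun ℓ => E L q σ d ℓ) (Finset.mem_univ x)
    refine main_dir L q hL σ d x (by omega) ?_ (by omega)
    intro ℓ hℓ
    apply bridge_of_lt
    have hz : ∑ ℓ ∈ Finset.univ.erase x, E L q σ d ℓ = 0 := by omega
    rw [Finset.sum_eq_zero_iff] at hz
    rw [hz ℓ (by simp [hℓ])]
    omega

/-- Proposition 6.7 (hexagonal lattice): a cross-free configuration with `H(σ) = 2L+1`
is a canonical configuration `σ ∈ C^{a,b}_{n,o}` (odd protuberance) for some `a ≠ b`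
and `n ∈ [0, L-1]`; moreover the protuberance has `2L-1` triangles when `n = 0` and
`1` triangle when `n = L-1`. -/
theorem crossfree_energy_2L1_canonical (L q : ℕ) (hL : 8 ≤ L) (hq : 2 ≤ q)
    (σ : Conf L q) (hcf : CrossFree L q σ) (hH : Ham L q σ = 2 * L + 1) :
    ∃ (a b : Fin q) (n : ℕ) (d : Fin 3) (P P' : Set (ZMod L)) (ℓ : ZMod L)
      (U : Set (Site L)),
      a ≠ b ∧ n ≤ L - 1 ∧ StepPair L P P' ∧ P.ncard = n ∧ P' \ P = {ℓ} ∧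
      IsProtuberance L d P ℓ U ∧ Odd U.ncard ∧
      σ = xiConf L q a b (stripUnion L d P ∪ U) ∧
      (n = 0 → U.ncard = 2 * L - 1) ∧ (n = L - 1 → U.ncard = 1) := by
  exact goal_all L q hL σ hcf hH

end IsingHex
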